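/- arXiv:2209.02742 — 2 statements merged into one kernel-verified Lean document; each statement's English description precedes it below -/
import Mathlib

section
/- Under the centered functional quadratic model, assume the error ε has an even density that is non-increasing in |t| and strictly decreasing for |t| in a neighbourhood of 0, that X has the finite-dimensional Karhunen–Loève decomposition X = μ + Σ_{j=1}^q ξ_j φ_j with (φ_j) orthonormal in L²(0,1), and that for every nonzero triple (a, β, Υ) ∈ ℝ × H_q × F_q one has P(⟨X−μ, β⟩ + ⟨X−μ, Υ(X−μ)⟩ = a) < 1. Let ρ₁ be a bounded ρ-function and fix σ > 0 and p ≥ q. Then any minimizer (α(P), β(P), Υ(P)) over C_p = ℝ × H_p × F_p of the risk L(a, β, Υ, μ, σ) = E[ρ₁((y − a − ⟨X−μ, β⟩ − ⟨X−μ, Υ(X−μ)⟩)/σ)] satisfies α(P) = α₀, the orthogonal projection of β(P) onto H_q equals β_{0,q}, and the orthogonal projection of Υ(P) onto F_q equals Υ_{0,q}. Moreover, when p = q, the risk L is uniquely minimized over C_q at (α₀, β_{0,q}, Υ_{0,q}). -/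
open MeasureTheory Filter
open scoped RealInnerProductSpace ENNReal

noncomputable section

/-- A *bounded ρ-function*: bounded, continuous, even, non-decreasing on `[0,∞)`,
vanishing at `0`, with supremum `1`, and strictly increasing where it is below `1`. -/
def IsBoundedRho (ρ : ℝ → ℝ) : Prop :=
  (∀ t, 0 ≤ ρ t) ∧ (∀ t, ρ t ≤ 1) ∧ Continuous ρ ∧ (∀ t, ρ (-t) = ρ t) ∧
    MonotoneOn ρ (Set.Ici (0 : ℝ)) ∧ ρ 0 = 0 ∧ (⨆ t, ρ t) = 1 ∧
    ∀ u v : ℝ, 0 ≤ u → u < v → ρ v < 1 → ρ u < ρ v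

/-- The error has an even density `f₀`, non-increasing in `|t|` and strictly decreasing
for `|t|` in a neighbourhood of `0`. -/
def HasSymmUnimodalDensity {Ω : Type*} [MeasureSpace Ω] (ε : Ω → ℝ) : Prop :=
  ∃ f₀ : ℝ → ℝ, (∀ t, 0 ≤ f₀ t) ∧
    Measure.map ε (volume : Measure Ω)
      = (volume : Measure ℝ).withDensity (fun t => ENNReal.ofReal (f₀ t)) ∧
    (∀ t, f₀ (-t) = f₀ t) ∧ (∀ s t : ℝ, |s| ≤ |t| → f₀ t ≤ f₀ s) ∧
    ∃ δ : ℝ, 0 < δ ∧ ∀ s t : ℝ, 0 ≤ s → s < t → t ≤ δ → f₀ t < f₀ s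

variable {H : Type*} [NormedAddCommGroup H] [InnerProductSpace ℝ H]

/-- The rank-one operator `f ⊗ g : u ↦ ⟪f, u⟫ • g`. -/
def rankOne (f g : H) : H →L[ℝ] H := (innerSL ℝ f).smulRight g

/-- Membership in `H_p`, the linear span of `φ 0, …, φ (p-1)`. -/
def inSpan (φ : ℕ → H) (p : ℕ) (β : H) : Prop :=
  ∃ bcoef : Fin p → ℝ, β = ∑ j : Fin p, bcoef j • φ (j : ℕ)

/-- Membership in `F_p`, the symmetric operators spanned by `φ j ⊗ φ ℓ`, `j, ℓ < p`. -/
def inFSpan (φ : ℕ → H) (p : ℕ) (Υ : H →L[ℝ] H) : Prop :=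
  ∃ v : Fin p → Fin p → ℝ, (∀ j ℓ, v j ℓ = v ℓ j) ∧
    Υ = ∑ j : Fin p, ∑ ℓ : Fin p, v j ℓ • rankOne (φ (j : ℕ)) (φ (ℓ : ℕ))

/-- `T` is a Hilbert–Schmidt operator. -/
def IsHilbertSchmidt (T : H →L[ℝ] H) : Prop :=
  ∃ b : HilbertBasis ℕ ℝ H, Summable fun i => ‖T (b i)‖ ^ 2

/-- The Hilbert–Schmidt norm of `T`, computed in the Hilbert basis `b`. -/
def hsNorm (b : HilbertBasis ℕ ℝ H) (T : H →L[ℝ] H) : ℝ :=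
  Real.sqrt (∑' i, ‖T (b i)‖ ^ 2)

/-- The risk `L(a, β, Υ, ν, σ) = E ρ₁((y − a − ⟨X−ν, β⟩ − ⟨X−ν, Υ(X−ν)⟩)/σ)`. -/
def risk {Ω : Type*} [MeasureSpace Ω]
    (ρ₁ : ℝ → ℝ) (y : Ω → ℝ) (X : Ω → H) (a : ℝ) (β : H) (Υ : H →L[ℝ] H)
    (ν : H) (σ : ℝ) : ℝ :=
  ∫ ω, ρ₁ ((y ω - a - ⟪X ω - ν, β⟫ - ⟪X ω - ν, Υ (X ω - ν)⟫) / σ)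

theorem IsBoundedRho.comp_mul {ρ : ℝ → ℝ} (h : IsBoundedRho ρ) {k : ℝ} (hk : 0 < k) :
    IsBoundedRho fun t => ρ (k * t) := by
  obtain ⟨h0, h1, hc, he, hm, hz, hs, hstr⟩ := h
  refine ⟨fun t => h0 _, fun t => h1 _, by fun_prop, fun t => ?_, fun u hu v hv huv => ?_, ?_, ?_,
    fun u v hu huv hv => ?_⟩
  · simp only [mul_neg, he]
  · exact hm (mul_nonneg hk.le hu) (mul_nonneg hk.le hv) (by gcongr)
  · simpa using hz
  · rw [← hs]
    exact (mul_left_surjective₀ hk.ne').iSup_comp ρ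
  · exact hstr _ _ (mul_nonneg hk.le hu) (by gcongr) hv

theorem IsBoundedRho.pos {ρ : ℝ → ℝ} (h : IsBoundedRho ρ) {c : ℝ} (hc : 0 < c) : 0 < ρ c := by
  obtain ⟨-, -, -, -, -, hz, -, hstr⟩ := h
  rcases lt_or_ge (ρ c) 1 with h1 | h1
  · simpa [hz] using hstr 0 c le_rfl hc h1
  · linarith

theorem IsBoundedRho.le_of_abs_le {ρ : ℝ → ℝ} (h : IsBoundedRho ρ) {s t : ℝ} (hst : |s| ≤ |t|) :
    ρ s ≤ ρ t := by
  obtain ⟨-, -, -, he, hm, -⟩ := h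
  have habs : ∀ x, ρ |x| = ρ x := fun x => by
    rcases abs_choice x with hx | hx <;> rw [hx]
    exact he x
  rw [← habs s, ← habs t]
  exact hm (Set.mem_Ici.2 (abs_nonneg s)) (Set.mem_Ici.2 (abs_nonneg t)) hst

theorem IsBoundedRho.norm_le_one {ρ : ℝ → ℝ} (h : IsBoundedRho ρ) (t : ℝ) : ‖ρ t‖ ≤ 1 := by
  rw [Real.norm_of_nonneg (h.1 t)]
  exact h.2.1 t

theorem measurable_of_antitone_abs {f : ℝ → ℝ} (hf : ∀ s t : ℝ, |s| ≤ |t| → f t ≤ f s) :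
    Measurable f := by
  have hanti : Antitone fun t => f (max t 0) := fun s t hst => hf _ _ <| by
    rw [abs_of_nonneg (le_max_right _ _), abs_of_nonneg (le_max_right _ _)]
    gcongr
  convert hanti.measurable.comp (measurable_norm (α := ℝ)) using 1
  ext t
  have habs : |(max |t| 0)| = |t| := by
    rw [max_eq_left (abs_nonneg t), abs_abs]
  exact le_antisymm (hf _ _ habs.le) (hf _ _ habs.ge)

/-- Twice the excess of the symmetric shift integral over its value at zero is the integral of a
product of two increments. -/
theorem integral_shift_sub_eq {ρ f : ℝ → ℝ} (hρ : IsBoundedRho ρ) (hf : Integrable f)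
    (heven : ∀ t, f (-t) = f t) (c : ℝ) :
    ∫ s, (ρ (s + c) - ρ s) * (f s - f (s + c))
      = 2 * ((∫ s, ρ (s - c) * f s) - ∫ s, ρ s * f s) := by
  have hc := hρ.2.2.1
  have hint : ∀ a b : ℝ, Integrable fun s => ρ (s + a) * f (s + b) := fun a b =>
    (hf.comp_add_right b).bdd_mul (c := 1)
      (by fun_prop : Continuous fun s => ρ (s + a)).aestronglyMeasurable
      (Eventually.of_forall fun s => hρ.norm_le_one _)
  have i1 : ∫ s, ρ (s + c) * f s = ∫ s, ρ (s - c) * f s := by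
    rw [← integral_neg_eq_self]
    refine integral_congr_ae (Eventually.of_forall fun s => ?_)
    simp only [heven]
    rw [← hρ.2.2.2.1]
    congr 2
    ring
  have i2 : ∫ s, ρ s * f (s + c) = ∫ s, ρ (s - c) * f s := by
    rw [← integral_add_right_eq_self (fun s => ρ (s - c) * f s) c]
    simp
  have i3 : ∫ s, ρ (s + c) * f (s + c) = ∫ s, ρ s * f s :=
    integral_add_right_eq_self (fun s => ρ s * f s) c
  have h00 := hint 0 0
  have h01 := hint 0 c
  have h10 := hint c 0
  have h11 := hint c c
  simp only [add_zero] at h00 h01 h10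
  calc ∫ s, (ρ (s + c) - ρ s) * (f s - f (s + c))
      = ∫ s, ((ρ (s + c) * f s + ρ s * f (s + c)) - (ρ (s + c) * f (s + c) + ρ s * f s)) := by
        congr 1; ext s; ring
    _ = _ := by
        rw [integral_sub (by exact h10.add h01) (by exact h11.add h00), integral_add h10 h01,
          integral_add h11 h00, i1, i2, i3]
        ring

theorem integral_mul_lt_integral_shift_of_pos {ρ f : ℝ → ℝ} (hρ : IsBoundedRho ρ)
    (hf : Integrable f) (heven : ∀ t, f (-t) = f t) (hmono : ∀ s t : ℝ, |s| ≤ |t| → f t ≤ f s)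
    {δ : ℝ} (hδ : 0 < δ) (hstrict : ∀ s t : ℝ, 0 ≤ s → s < t → t ≤ δ → f t < f s)
    {c : ℝ} (hc : 0 < c) :
    ∫ s, ρ s * f s < ∫ s, ρ (s - c) * f s := by
  have hcont := hρ.2.2.1
  have hnonneg : ∀ s, 0 ≤ (ρ (s + c) - ρ s) * (f s - f (s + c)) := fun s => by
    rcases le_total |s| |s + c| with h | h
    · exact mul_nonneg (sub_nonneg.2 (hρ.le_of_abs_le h)) (sub_nonneg.2 (hmono _ _ h))
    · exact mul_nonneg_of_nonpos_of_nonpos (sub_nonpos.2 (hρ.le_of_abs_le h))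
        (sub_nonpos.2 (hmono _ _ h))
  have hint : Integrable fun s => (ρ (s + c) - ρ s) * (f s - f (s + c)) := by
    refine (hf.sub (hf.comp_add_right c)).bdd_mul (c := 2)
      (by fun_prop : Continuous fun s => ρ (s + c) - ρ s).aestronglyMeasurable
      (Eventually.of_forall fun s => (norm_sub_le _ _).trans ?_)
    linarith [hρ.norm_le_one (s + c), hρ.norm_le_one s]
  obtain ⟨η, hη, hηρ⟩ : ∃ η > 0, ∀ s, 0 < s → s < η → ρ s < ρ c := by
    have hev : ∀ᶠ s in nhds (0 : ℝ), ρ s < ρ c :=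
      hcont.continuousAt.eventually_lt_const (by rw [hρ.2.2.2.2.2.1]; exact hρ.pos hc)
    obtain ⟨η, hη, h⟩ := Metric.eventually_nhds_iff.1 hev
    exact ⟨η, hη, fun s h0 h1 => h (by rwa [Real.dist_eq, sub_zero, abs_of_pos h0])⟩
  have hpos : 0 < ∫ s, (ρ (s + c) - ρ s) * (f s - f (s + c)) := by
    rw [integral_pos_iff_support_of_nonneg hnonneg hint]
    have hsub : Set.Ioo 0 (min η δ)
        ⊆ Function.support fun s => (ρ (s + c) - ρ s) * (f s - f (s + c)) := by
      rintro s ⟨hs0, hs1⟩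
      have hsη := hs1.trans_le (min_le_left _ _)
      have hsδ := hs1.trans_le (min_le_right _ _)
      have h1 : ρ c ≤ ρ (s + c) := hρ.le_of_abs_le <| by
        rw [abs_of_pos hc, abs_of_pos (by positivity)]; linarith
      have h2 : f (s + c) ≤ f (min (s + c) δ) := hmono _ _ <| by
        rw [abs_of_pos (by positivity), abs_of_pos (by positivity)]; exact min_le_left _ _
      have h3 : f (min (s + c) δ) < f s :=
        hstrict _ _ hs0.le (lt_min (by linarith) hsδ) (min_le_right _ _)
      exact (mul_pos (by linarith [hηρ s hs0 hsη]) (by linarith)).ne'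
    refine lt_of_lt_of_le ?_ (measure_mono hsub)
    simp [hη, hδ]
  rw [integral_shift_sub_eq hρ hf heven] at hpos
  linarith

theorem integral_mul_lt_integral_shift {ρ f : ℝ → ℝ} (hρ : IsBoundedRho ρ)
    (hf : Integrable f) (heven : ∀ t, f (-t) = f t) (hmono : ∀ s t : ℝ, |s| ≤ |t| → f t ≤ f s)
    {δ : ℝ} (hδ : 0 < δ) (hstrict : ∀ s t : ℝ, 0 ≤ s → s < t → t ≤ δ → f t < f s)
    {c : ℝ} (hc : c ≠ 0) :
    ∫ s, ρ s * f s < ∫ s, ρ (s - c) * f s := by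
  rcases hc.lt_or_gt with h | h
  · have hneg : ∫ s, ρ (s - c) * f s = ∫ s, ρ (s - -c) * f s := by
      rw [← integral_neg_eq_self]
      refine integral_congr_ae (Eventually.of_forall fun s => ?_)
      simp only [heven]
      rw [← hρ.2.2.2.1]
      congr 2
      ring
    rw [hneg]
    exact integral_mul_lt_integral_shift_of_pos hρ hf heven hmono hδ hstrict (neg_pos.2 h)
  · exact integral_mul_lt_integral_shift_of_pos hρ hf heven hmono hδ hstrict h

section Probability

variable {Ω : Type*} [MeasureSpace Ω] [IsProbabilityMeasure (volume : Measure Ω)]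

theorem HasSymmUnimodalDensity.integral_lt_integral_sub {ε : Ω → ℝ} (hε : Measurable ε)
    (hd : HasSymmUnimodalDensity ε) {ρ : ℝ → ℝ} (hρ : IsBoundedRho ρ) {c : ℝ} (hc : c ≠ 0) :
    ∫ e, ρ e ∂(Measure.map ε volume) < ∫ e, ρ (e - c) ∂(Measure.map ε volume) := by
  obtain ⟨f, hf0, hmap, heven, hmono, δ, hδ, hstrict⟩ := hd
  have hfm := measurable_of_antitone_abs hmono
  have hfi : Integrable f := by
    refine ⟨hfm.aestronglyMeasurable, ?_⟩
    rw [hasFiniteIntegral_iff_ofReal (Eventually.of_forall hf0)]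
    have : IsProbabilityMeasure (Measure.map ε (volume : Measure Ω)) :=
      Measure.isProbabilityMeasure_map hε.aemeasurable
    have huniv := measure_lt_top (Measure.map ε (volume : Measure Ω)) Set.univ
    rwa [hmap, withDensity_apply _ MeasurableSet.univ, Measure.restrict_univ] at huniv
  have hdens : ∀ g : ℝ → ℝ, ∫ e, g e ∂(Measure.map ε volume) = ∫ s, g s * f s := fun g => by
    rw [hmap, integral_withDensity_eq_integral_toReal_smul hfm.ennreal_ofReal
      (Eventually.of_forall fun _ => ENNReal.ofReal_lt_top)]
    simp [ENNReal.toReal_ofReal (hf0 _), mul_comm]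
  rw [hdens ρ, hdens fun e => ρ (e - c)]
  exact integral_mul_lt_integral_shift hρ hfi heven hmono hδ hstrict hc

/-- Perturbing the error by a nonzero independent variable strictly increases the expected loss. -/
theorem HasSymmUnimodalDensity.integral_lt_integral_sub_of_indepFun {ε Z : Ω → ℝ}
    (hε : Measurable ε) (hZ : Measurable Z) (hd : HasSymmUnimodalDensity ε)
    (hind : ProbabilityTheory.IndepFun ε Z (volume : Measure Ω)) {ρ : ℝ → ℝ}
    (hρ : IsBoundedRho ρ) (hne : ¬ ∀ᵐ ω, Z ω = 0) :
    ∫ ω, ρ (ε ω) < ∫ ω, ρ (ε ω - Z ω) := by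
  have hc := hρ.2.2.1
  have hpε : IsProbabilityMeasure (Measure.map ε (volume : Measure Ω)) :=
    Measure.isProbabilityMeasure_map hε.aemeasurable
  have hpZ : IsProbabilityMeasure (Measure.map Z (volume : Measure Ω)) :=
    Measure.isProbabilityMeasure_map hZ.aemeasurable
  have hF : Continuous fun x : ℝ × ℝ => ρ (x.2 - x.1) := by fun_prop
  have hprod : Measure.map (fun ω => (Z ω, ε ω)) volume
      = (Measure.map Z volume).prod (Measure.map ε (volume : Measure Ω)) :=
    (ProbabilityTheory.indepFun_iff_map_prod_eq_prod_map_map hZ.aemeasurable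
      hε.aemeasurable).1 hind.symm
  have hint : Integrable (fun x : ℝ × ℝ => ρ (x.2 - x.1))
      ((Measure.map Z volume).prod (Measure.map ε (volume : Measure Ω))) :=
    .of_bound hF.aestronglyMeasurable 1 (Eventually.of_forall fun _ => hρ.norm_le_one _)
  have hR : ∫ ω, ρ (ε ω - Z ω)
      = ∫ z, ∫ e, ρ (e - z) ∂(Measure.map ε volume) ∂(Measure.map Z volume) := by
    rw [← integral_prod (fun x : ℝ × ℝ => ρ (x.2 - x.1)) hint, ← hprod,
      integral_map (hZ.prodMk hε).aemeasurable hF.aestronglyMeasurable]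
  rw [hR, ← integral_map hε.aemeasurable hc.aestronglyMeasurable]
  set B := ∫ e, ρ e ∂(Measure.map ε volume)
  set A : ℝ → ℝ := fun z => ∫ e, ρ (e - z) ∂(Measure.map ε volume)
  have hAi : Integrable A (Measure.map Z volume) := hint.integral_prod_left
  have hlt : ∀ z ≠ 0, B < A z := fun z hz => hd.integral_lt_integral_sub hε hρ hz
  have hle : ∀ z, 0 ≤ A z - B := fun z => by
    rcases eq_or_ne z 0 with rfl | hz
    · simp [A, B]
    · exact sub_nonneg.2 (hlt z hz).le
  have hsub : ∫ z, (A z - B) ∂(Measure.map Z volume) = (∫ z, A z ∂(Measure.map Z volume)) - B := by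
    rw [integral_sub hAi (integrable_const _)]
    simp
  refine sub_pos.1 (hsub ▸ lt_of_le_of_ne (integral_nonneg hle) fun h => hne ?_)
  have hzero := (integral_eq_zero_iff_of_nonneg hle (hAi.sub (integrable_const _))).1 h.symm
  filter_upwards [ae_of_ae_map hZ.aemeasurable hzero] with ω hω
  by_contra hz
  exact (sub_pos.2 (hlt _ hz)).ne' hω

end Probability

section Projection

theorem inSpan.mono {φ : ℕ → H} {q p : ℕ} (hqp : q ≤ p) {β : H} (h : inSpan φ q β) :
    inSpan φ p β := by
  obtain ⟨b, rfl⟩ := h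
  refine ⟨fun j => if h : (j : ℕ) < q then b ⟨j, h⟩ else 0, ?_⟩
  obtain ⟨r, rfl⟩ := Nat.exists_eq_add_of_le hqp
  simp [Fin.sum_univ_add]

theorem inFSpan.mono {φ : ℕ → H} {q p : ℕ} (hqp : q ≤ p) {Υ : H →L[ℝ] H} (h : inFSpan φ q Υ) :
    inFSpan φ p Υ := by
  obtain ⟨v, hv, rfl⟩ := h
  refine ⟨fun j l => if h : (j : ℕ) < q ∧ (l : ℕ) < q then v ⟨j, h.1⟩ ⟨l, h.2⟩ else 0, ?_, ?_⟩
  · intro j l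
    by_cases h : (j : ℕ) < q ∧ (l : ℕ) < q
    · simp [h, hv ⟨j, h.1⟩]
    · simp only [dif_neg h, dif_neg fun h' => h (And.symm h')]
  · obtain ⟨r, rfl⟩ := Nat.exists_eq_add_of_le hqp
    simp [Fin.sum_univ_add]

theorem inFSpan.inner_comm {φ : ℕ → H} {p : ℕ} {Υ : H →L[ℝ] H} (h : inFSpan φ p Υ) (u v : H) :
    ⟪u, Υ v⟫ = ⟪v, Υ u⟫ := by
  obtain ⟨w, hw, rfl⟩ := h
  simp only [rankOne, sum_apply, smul_apply,
    ContinuousLinearMap.smulRight_apply, innerSL_apply_apply, inner_sum, inner_smul_right]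
  rw [Finset.sum_comm]
  refine Finset.sum_congr rfl fun j _ => Finset.sum_congr rfl fun l _ => ?_
  rw [hw l j, real_inner_comm u, real_inner_comm v]
  ring

/-- The orthogonal projection onto `H_q`. -/
def spanProj (φ : ℕ → H) (q : ℕ) (β : H) : H :=
  ∑ j : Fin q, ⟪φ j, β⟫ • φ j

/-- The Hilbert–Schmidt orthogonal projection onto the span of the `φ j ⊗ φ ℓ`, `j, ℓ < q`. -/
def fSpanProj (φ : ℕ → H) (q : ℕ) (Υ : H →L[ℝ] H) : H →L[ℝ] H :=
  ∑ j : Fin q, ∑ l : Fin q, ⟪φ j, Υ (φ l)⟫ • rankOne (φ j) (φ l)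

theorem spanProj_inSpan (φ : ℕ → H) (q : ℕ) (β : H) : inSpan φ q (spanProj φ q β) :=
  ⟨_, rfl⟩

theorem fSpanProj_inFSpan (φ : ℕ → H) (q : ℕ) {Υ : H →L[ℝ] H}
    (h : ∀ u v, ⟪u, Υ v⟫ = ⟪v, Υ u⟫) : inFSpan φ q (fSpanProj φ q Υ) :=
  ⟨fun j l => ⟪φ j, Υ (φ l)⟫, fun _ _ => h _ _, rfl⟩

theorem spanProj_sub (φ : ℕ → H) (q : ℕ) (β β' : H) :
    spanProj φ q (β - β') = spanProj φ q β - spanProj φ q β' := by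
  simp [spanProj, inner_sub_right, sub_smul, Finset.sum_sub_distrib]

theorem fSpanProj_sub (φ : ℕ → H) (q : ℕ) (Υ Υ' : H →L[ℝ] H) :
    fSpanProj φ q (Υ - Υ') = fSpanProj φ q Υ - fSpanProj φ q Υ' := by
  simp [fSpanProj, inner_sub_right, sub_smul, Finset.sum_sub_distrib]

theorem inSpan.spanProj_eq {φ : ℕ → H} {q : ℕ} (hφ : Orthonormal ℝ φ) {β : H}
    (h : inSpan φ q β) : spanProj φ q β = β := by
  obtain ⟨b, rfl⟩ := h
  refine Finset.sum_congr rfl fun l _ => ?_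
  congr 1
  simpa using (hφ.comp _ Fin.val_injective).inner_right_fintype b l

theorem inFSpan.fSpanProj_eq {φ : ℕ → H} {q : ℕ} (hφ : Orthonormal ℝ φ) {Υ : H →L[ℝ] H}
    (h : inFSpan φ q Υ) : fSpanProj φ q Υ = Υ := by
  obtain ⟨v, hv, rfl⟩ := h
  refine Finset.sum_congr rfl fun j _ => Finset.sum_congr rfl fun l _ => ?_
  congr 1
  have hδ : ∀ i k : Fin q, ⟪φ i, φ k⟫ = if i = k then (1 : ℝ) else 0 := fun i k => by
    simpa [Fin.ext_iff] using orthonormal_iff_ite.1 hφ i k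
  simp only [rankOne, sum_apply, smul_apply, ContinuousLinearMap.smulRight_apply,
    innerSL_apply_apply, inner_sum, inner_smul_right, hδ]
  simp [hv l j]

theorem inner_spanProj {φ : ℕ → H} {q : ℕ} (hφ : Orthonormal ℝ φ) (b : Fin q → ℝ) (β : H) :
    ⟪∑ j : Fin q, b j • φ j, spanProj φ q β⟫ = ⟪∑ j : Fin q, b j • φ j, β⟫ := by
  have h := (hφ.comp _ Fin.val_injective).inner_sum b (fun j : Fin q => ⟪φ j, β⟫) Finset.univ
  simp only [Function.comp] at h
  rw [spanProj, h]
  simp [sum_inner, inner_smul_left]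

theorem inner_fSpanProj_apply {φ : ℕ → H} {q : ℕ} (hφ : Orthonormal ℝ φ) (b : Fin q → ℝ)
    (Υ : H →L[ℝ] H) :
    ⟪∑ j : Fin q, b j • φ j, fSpanProj φ q Υ (∑ j : Fin q, b j • φ j)⟫
      = ⟪∑ j : Fin q, b j • φ j, Υ (∑ j : Fin q, b j • φ j)⟫ := by
  have hl : ∀ l : Fin q, ⟪φ l, ∑ j : Fin q, b j • φ j⟫ = b l := fun l => by
    simpa using (hφ.comp _ Fin.val_injective).inner_right_fintype b l
  have hr : ∀ l : Fin q, ⟪∑ j : Fin q, b j • φ j, φ l⟫ = b l := fun l => by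
    rw [real_inner_comm, hl]
  have hR : ⟪∑ j : Fin q, b j • φ j, Υ (∑ j : Fin q, b j • φ j)⟫
      = ∑ j : Fin q, ∑ l : Fin q, b j * (b l * ⟪φ j, Υ (φ l)⟫) := by
    simp only [map_sum, map_smul, sum_inner, inner_sum, real_inner_smul_left, inner_smul_right,
      Finset.mul_sum]
    rw [Finset.sum_comm]
    exact Finset.sum_congr rfl fun j _ => Finset.sum_congr rfl fun l _ => by ring
  rw [hR]
  simp only [fSpanProj, rankOne, sum_apply, smul_apply, ContinuousLinearMap.smulRight_apply,
    innerSL_apply_apply, inner_sum, inner_smul_right, hl, hr]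
  refine Finset.sum_congr rfl fun j _ => Finset.sum_congr rfl fun l _ => ?_
  ring

end Projection

/-- Proposition 3.1, Fisher-consistency for finite-dimensional processes:
under the centered functional quadratic model with finite-dimensional Karhunen–Loève
decomposition `X = μ + Σ_{j<q} ξ_j φ_j` and the non-degeneracy condition C5, any minimizer
`(αP, βP, ΥP)` of the risk over `C_p = ℝ × H_p × F_p` (for `p ≥ q`) satisfies `αP = α₀`,
its projections onto `H_q` and `F_q` are `β_{0,q}` and `Υ_{0,q}`, and for `p = q` the risk
is uniquely minimized over `C_q` at `(α₀, β_{0,q}, Υ_{0,q})`. -/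
theorem statement0
    {Ω H : Type*} [MeasureSpace Ω] [IsProbabilityMeasure (volume : Measure Ω)]
    [NormedAddCommGroup H] [InnerProductSpace ℝ H] [CompleteSpace H]
    [MeasurableSpace H] [BorelSpace H]
    (X : Ω → H) (ε y : Ω → ℝ) (hX : Measurable X) (hε : Measurable ε)
    (μ : H) (α₀ : ℝ) (β₀ : H) (Υ₀ : H →L[ℝ] H) (σ₀ : ℝ) (hσ₀ : 0 < σ₀)
    (hsa₀ : ∀ u v : H, ⟪Υ₀ u, v⟫ = ⟪u, Υ₀ v⟫) (hHS₀ : IsHilbertSchmidt Υ₀)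
    (hmodel : ∀ ω, y ω = α₀ + ⟪β₀, X ω - μ⟫ + ⟪X ω - μ, Υ₀ (X ω - μ)⟫ + σ₀ * ε ω)
    (hindep : ProbabilityTheory.IndepFun ε X (volume : Measure Ω))
    (hdens : HasSymmUnimodalDensity ε)
    -- finite-dimensional Karhunen–Loève decomposition with orthonormal `φ`
    (q : ℕ) (φ : ℕ → H) (hortho : Orthonormal ℝ φ)
    (ξ : Fin q → Ω → ℝ)
    (hKL : ∀ ω, X ω = μ + ∑ j : Fin q, ξ j ω • φ (j : ℕ))
    -- condition C5
    (hnondeg : ∀ (a : ℝ) (β : H) (Υ : H →L[ℝ] H),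
      inSpan φ q β → inFSpan φ q Υ → ¬(a = 0 ∧ β = 0 ∧ Υ = 0) →
      volume {ω | ⟪X ω - μ, β⟫ + ⟪X ω - μ, Υ (X ω - μ)⟫ = a} < 1)
    (ρ₁ : ℝ → ℝ) (hρ₁ : IsBoundedRho ρ₁)
    (σ : ℝ) (hσ : 0 < σ)
    (p : ℕ) (hpq : q ≤ p)
    -- `(αP, βP, ΥP)` minimizes the risk over `C_p`
    (αP : ℝ) (βP : H) (ΥP : H →L[ℝ] H)
    (hβP : inSpan φ p βP) (hΥP : inFSpan φ p ΥP)
    (hmin : ∀ (a : ℝ) (β : H) (Υ : H →L[ℝ] H), inSpan φ p β → inFSpan φ p Υ →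
      risk ρ₁ y X αP βP ΥP μ σ ≤ risk ρ₁ y X a β Υ μ σ) :
    αP = α₀ ∧
    (∑ j : Fin q, ⟪φ (j : ℕ), βP⟫ • φ (j : ℕ))
      = (∑ j : Fin q, ⟪β₀, φ (j : ℕ)⟫ • φ (j : ℕ)) ∧
    (∑ j : Fin q, ∑ ℓ : Fin q, ⟪φ (j : ℕ), ΥP (φ (ℓ : ℕ))⟫ • rankOne (φ (j : ℕ)) (φ (ℓ : ℕ)))
      = (∑ j : Fin q, ∑ ℓ : Fin q,
          ⟪φ (j : ℕ), Υ₀ (φ (ℓ : ℕ))⟫ • rankOne (φ (j : ℕ)) (φ (ℓ : ℕ))) ∧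
    (p = q →
      ∀ (a : ℝ) (β : H) (Υ : H →L[ℝ] H), inSpan φ q β → inFSpan φ q Υ →
        ¬(a = α₀ ∧ β = (∑ j : Fin q, ⟪β₀, φ (j : ℕ)⟫ • φ (j : ℕ)) ∧
            Υ = (∑ j : Fin q, ∑ ℓ : Fin q,
              ⟪φ (j : ℕ), Υ₀ (φ (ℓ : ℕ))⟫ • rankOne (φ (j : ℕ)) (φ (ℓ : ℕ)))) →
        risk ρ₁ y X α₀ (∑ j : Fin q, ⟪β₀, φ (j : ℕ)⟫ • φ (j : ℕ))
            (∑ j : Fin q, ∑ ℓ : Fin q,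
              ⟪φ (j : ℕ), Υ₀ (φ (ℓ : ℕ))⟫ • rankOne (φ (j : ℕ)) (φ (ℓ : ℕ))) μ σ
          < risk ρ₁ y X a β Υ μ σ) := by
  have hXμ : ∀ ω, X ω - μ = ∑ j : Fin q, ξ j ω • φ (j : ℕ) := fun ω => by rw [hKL ω]; simp
  have hsym₀ : ∀ u v : H, ⟪u, Υ₀ v⟫ = ⟪v, Υ₀ u⟫ := fun u v => by
    rw [← hsa₀, real_inner_comm]
  have hρ' := hρ₁.comp_mul (div_pos hσ₀ hσ)
  have hrisk : ∀ (a : ℝ) (β : H) (Υ : H →L[ℝ] H), risk ρ₁ y X a β Υ μ σ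
      = ∫ ω, ρ₁ (σ₀ / σ * (ε ω - (a - α₀ + ⟪X ω - μ, spanProj φ q (β - β₀)⟫
          + ⟪X ω - μ, fSpanProj φ q (Υ - Υ₀) (X ω - μ)⟫) / σ₀)) := fun a β Υ => by
    refine integral_congr_ae (Eventually.of_forall fun ω => congrArg ρ₁ ?_)
    simp only [hmodel ω, hXμ ω, inner_spanProj hortho, inner_fSpanProj_apply hortho]
    rw [sub_apply, inner_sub_right, inner_sub_right, real_inner_comm _ β₀]
    field_simp
    ring
  have hlt : ∀ (a : ℝ) (β : H) (Υ : H →L[ℝ] H), (∀ u v, ⟪u, Υ v⟫ = ⟪v, Υ u⟫) →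
      ¬(a = α₀ ∧ spanProj φ q β = spanProj φ q β₀ ∧ fSpanProj φ q Υ = fSpanProj φ q Υ₀) →
      ∫ ω, ρ₁ (σ₀ / σ * ε ω) < risk ρ₁ y X a β Υ μ σ := fun a β Υ hΥ hne => by
    rw [hrisk]
    have hG : Measurable fun x : H => (a - α₀ + ⟪x - μ, spanProj φ q (β - β₀)⟫
        + ⟪x - μ, fSpanProj φ q (Υ - Υ₀) (x - μ)⟫) / σ₀ :=
      Continuous.measurable (by fun_prop)
    refine hdens.integral_lt_integral_sub_of_indepFun hε (hG.comp hX)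
      (hindep.comp measurable_id hG) hρ' fun hae => ?_
    refine (hnondeg (α₀ - a) (spanProj φ q (β - β₀)) (fSpanProj φ q (Υ - Υ₀))
      (spanProj_inSpan _ _ _) (fSpanProj_inFSpan _ _ fun u v => ?_) fun h => hne ?_).ne ?_
    · rw [sub_apply, sub_apply, inner_sub_right, inner_sub_right, hΥ u v, hsym₀ u v]
    · rw [spanProj_sub, fSpanProj_sub, sub_eq_zero, sub_eq_zero, sub_eq_zero] at h
      exact ⟨h.1.symm, h.2⟩
    · refine (measure_congr (eventuallyEq_univ.2 ?_)).trans measure_univ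
      filter_upwards [hae] with ω hω
      have h0 := (div_eq_zero_iff.1 hω).resolve_right hσ₀.ne'
      linarith
  have hmin₀ : risk ρ₁ y X α₀ (spanProj φ q β₀) (fSpanProj φ q Υ₀) μ σ
      = ∫ ω, ρ₁ (σ₀ / σ * ε ω) := by
    rw [hrisk, spanProj_sub, fSpanProj_sub, (spanProj_inSpan φ q β₀).spanProj_eq hortho,
      (fSpanProj_inFSpan φ q hsym₀).fSpanProj_eq hortho]
    simp
  have hproj : (∑ j : Fin q, ⟪β₀, φ (j : ℕ)⟫ • φ (j : ℕ)) = spanProj φ q β₀ :=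
    Finset.sum_congr rfl fun j _ => by rw [real_inner_comm]
  have hP : αP = α₀ ∧ spanProj φ q βP = spanProj φ q β₀
      ∧ fSpanProj φ q ΥP = fSpanProj φ q Υ₀ := by
    by_contra hne
    exact (hlt αP βP ΥP hΥP.inner_comm hne).not_ge <| (hmin _ _ _
      ((spanProj_inSpan φ q β₀).mono hpq)
      ((fSpanProj_inFSpan φ q hsym₀).mono hpq)).trans hmin₀.le
  rw [hproj]
  refine ⟨hP.1, hP.2.1, hP.2.2, fun _ a β Υ hβ hΥ hne => ?_⟩
  refine hmin₀.trans_lt (hlt a β Υ hΥ.inner_comm ?_)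
  rwa [hβ.spanProj_eq hortho, hΥ.fSpanProj_eq hortho]
end
end

section
/- Under the centered functional quadratic model with E‖X‖² < ∞, assume the error ε has an even density that is non-increasing in |t| and strictly decreasing for |t| in a neighbourhood of 0, and let (φ_j)_{j≥1} be the orthonormal eigenfunctions of the covariance operator Γ of X. Let ρ₁ be a bounded ρ-function, and for each p let (α_p(P), β_p(P), Υ_p(P)) be a minimizer of L(a, β, Υ, μ, σ₀) over C_p = ℝ × H_p × F_p. Then lim_{p→∞} L(α_p(P), β_p(P), Υ_p(P), μ, σ₀) = lim_{p→∞} min_{(a,β,Υ)∈C_p} L(a, β, Υ, μ, σ₀) = L(α₀, β₀, Υ₀, μ, σ₀). -/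
open MeasureTheory Filter
open scoped RealInnerProductSpace ENNReal

noncomputable section

variable {H : Type*} [NormedAddCommGroup H] [InnerProductSpace ℝ H]

/-- A one-dimensional Anderson inequality: against a symmetric unimodal density, a shift
cannot decrease the expected loss. -/
theorem integral_rho_mul_le_integral_rho_add_mul {ρ f : ℝ → ℝ} (hρ : IsBoundedRho ρ)
    (hf : Integrable f) (hf_even : ∀ t, f (-t) = f t)
    (hf_anti : ∀ s t : ℝ, |s| ≤ |t| → f t ≤ f s) (c : ℝ) :
    ∫ t, ρ t * f t ≤ ∫ t, ρ (t + c) * f t := by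
  obtain ⟨h0, h1, hc, heven, hmono, -⟩ := hρ
  have habs : ∀ t, ρ |t| = ρ t := fun t => by
    rcases abs_choice t with h | h <;> rw [h]
    exact heven t
  have hle : ∀ s t : ℝ, |s| ≤ |t| → ρ s ≤ ρ t := fun s t hst => by
    rw [← habs s, ← habs t]
    exact hmono (abs_nonneg s) (abs_nonneg t) hst
  have hint : ∀ d e : ℝ, Integrable fun t => ρ (t + d) * f (t + e) := fun d e =>
    (hf.comp_add_right e).bdd_mul (c := 1) (by fun_prop)
      (Eventually.of_forall fun t => by simpa [abs_of_nonneg (h0 _)] using h1 (t + d))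
  have i₁ : Integrable fun t => ρ (t + c) * f t := by simpa using hint c 0
  have i₂ : Integrable fun t => ρ t * f t := by simpa using hint 0 0
  have i₃ : Integrable fun t => ρ t * f (t + c) := by simpa using hint 0 c
  have e₁ : ∫ t, ρ (t + c) * f t = ∫ t, ρ t * f (t + c) := by
    rw [← integral_sub_left_eq_self (fun t => ρ (t + c) * f t) volume (-c)]
    congr! 2 with t
    rw [show -c - t + c = -t by ring, show -c - t = -(t + c) by ring, heven, hf_even]
  have e₂ : ∫ t, ρ t * f t = ∫ t, ρ (t + c) * f (t + c) :=
    (integral_add_right_eq_self (fun t => ρ t * f t) c).symm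
  have key : 0 ≤ ∫ t, (ρ (t + c) - ρ t) * (f t - f (t + c)) := by
    refine integral_nonneg fun t => ?_
    rcases le_total |t| |t + c| with h | h
    · exact mul_nonneg (sub_nonneg.2 (hle _ _ h)) (sub_nonneg.2 (hf_anti _ _ h))
    · exact mul_nonneg_of_nonpos_of_nonpos (sub_nonpos.2 (hle _ _ h))
        (sub_nonpos.2 (hf_anti _ _ h))
  have expand : ∫ t, (ρ (t + c) - ρ t) * (f t - f (t + c)) =
      (∫ t, ρ (t + c) * f t) + (∫ t, ρ t * f (t + c)) -
        ((∫ t, ρ t * f t) + ∫ t, ρ (t + c) * f (t + c)) := by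
    rw [← integral_add i₁ i₃, ← integral_add i₂ (hint c c),
      ← integral_sub (by exact i₁.add i₃) (by exact i₂.add (hint c c))]
    refine integral_congr_ae (Eventually.of_forall fun t => ?_)
    ring
  linarith

theorem integral_rho_le_integral_rho_add {Ω : Type*} [MeasureSpace Ω]
    [IsProbabilityMeasure (volume : Measure Ω)] {ρ : ℝ → ℝ} {ε : Ω → ℝ}
    (hρ : IsBoundedRho ρ) (hdens : HasSymmUnimodalDensity ε) (hε : Measurable ε) (c : ℝ) :
    ∫ t, ρ t ∂(volume.map ε) ≤ ∫ t, ρ (t + c) ∂(volume.map ε) := by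
  obtain ⟨f, hf0, hmap, hf_even, hf_anti, -⟩ := hdens
  have hf_abs : ∀ t, f (max |t| 0) = f t := fun t => by
    rw [max_eq_left (abs_nonneg t)]
    rcases abs_choice t with h | h <;> rw [h]
    exact hf_even t
  have hanti : Antitone fun s : ℝ => f (max s 0) := fun s t hst => hf_anti _ _ <| by
    rw [abs_of_nonneg (le_max_right s 0), abs_of_nonneg (le_max_right t 0)]
    exact max_le_max_right 0 hst
  have hfm : Measurable f := by
    have h := hanti.measurable.comp (measurable_id.abs (α := ℝ))
    simpa only [Function.comp_def, id, hf_abs] using h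
  have : IsProbabilityMeasure (volume.map ε) := Measure.isProbabilityMeasure_map hε.aemeasurable
  have hf : Integrable f := by
    refine ⟨hfm.aestronglyMeasurable, ?_⟩
    rw [hasFiniteIntegral_iff_ofReal (Eventually.of_forall hf0),
      ← setLIntegral_univ, ← withDensity_apply _ MeasurableSet.univ, ← hmap]
    exact measure_lt_top _ _
  have hint : ∀ g : ℝ → ℝ, ∫ t, g t ∂(volume.map ε) = ∫ t, g t * f t := fun g => by
    rw [hmap, integral_withDensity_eq_integral_toReal_smul hfm.ennreal_ofReal
      (Eventually.of_forall fun _ => ENNReal.ofReal_lt_top)]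
    refine integral_congr_ae (Eventually.of_forall fun t => ?_)
    dsimp only
    rw [ENNReal.toReal_ofReal (hf0 t), smul_eq_mul, mul_comm]
  rw [hint, hint]
  exact integral_rho_mul_le_integral_rho_add_mul hρ hf hf_even hf_anti c

theorem integral_rho_le_integral_rho_add_of_indepFun {Ω : Type*} [MeasureSpace Ω]
    [IsProbabilityMeasure (volume : Measure Ω)] {ρ : ℝ → ℝ} {ε Z : Ω → ℝ}
    (hρ : IsBoundedRho ρ) (hdens : HasSymmUnimodalDensity ε) (hε : Measurable ε)
    (hZ : Measurable Z) (hindep : ProbabilityTheory.IndepFun ε Z) :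
    ∫ ω, ρ (ε ω) ≤ ∫ ω, ρ (ε ω + Z ω) := by
  have hcont : Continuous ρ := hρ.2.2.1
  have hpε : IsProbabilityMeasure (volume.map ε) := Measure.isProbabilityMeasure_map hε.aemeasurable
  have hpZ : IsProbabilityMeasure (volume.map Z) := Measure.isProbabilityMeasure_map hZ.aemeasurable
  have hprod : volume.map (fun ω => (ε ω, Z ω)) = (volume.map ε).prod (volume.map Z) :=
    (ProbabilityTheory.indepFun_iff_map_prod_eq_prod_map_map hε.aemeasurable hZ.aemeasurable).1
      hindep
  have hint : Integrable (fun q : ℝ × ℝ => ρ (q.1 + q.2))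
      ((volume.map ε).prod (volume.map Z)) :=
    Integrable.of_bound (by fun_prop) 1
      (Eventually.of_forall fun q => by simpa [abs_of_nonneg (hρ.1 _)] using hρ.2.1 _)
  have hl : ∫ ω, ρ (ε ω) = ∫ t, ρ t ∂(volume.map ε) :=
    (integral_map hε.aemeasurable hcont.aestronglyMeasurable).symm
  have hr : ∫ ω, ρ (ε ω + Z ω) = ∫ z, ∫ t, ρ (t + z) ∂(volume.map ε) ∂(volume.map Z) := by
    rw [← integral_prod_symm _ hint, ← hprod,
      integral_map (hε.prodMk hZ).aemeasurable (by fun_prop)]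
  rw [hl, hr]
  calc ∫ t, ρ t ∂(volume.map ε)
      = ∫ _ : ℝ, ∫ t, ρ t ∂(volume.map ε) ∂(volume.map Z) := by simp
    _ ≤ _ := integral_mono (integrable_const _) hint.integral_prod_right
        fun z => integral_rho_le_integral_rho_add hρ hdens hε z

/-- The orthogonal projection of `x` on the span of `b 0, …, b (p-1)`. -/
def truncVec (b : HilbertBasis ℕ ℝ H) (x : H) (p : ℕ) : H :=
  ∑ j : Fin p, ⟪b j, x⟫ • b j

/-- The compression of `T` to the span of `b 0, …, b (p-1)`. -/
def truncOp (b : HilbertBasis ℕ ℝ H) (T : H →L[ℝ] H) (p : ℕ) : H →L[ℝ] H :=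
  ∑ j : Fin p, ∑ l : Fin p, ⟪b j, T (b l)⟫ • rankOne (b j) (b l)

theorem inSpan_truncVec (b : HilbertBasis ℕ ℝ H) (x : H) (p : ℕ) :
    inSpan (fun j => b j) p (truncVec b x p) :=
  ⟨fun j => ⟪b j, x⟫, rfl⟩

theorem inFSpan_truncOp (b : HilbertBasis ℕ ℝ H) {T : H →L[ℝ] H}
    (hT : ∀ u v : H, ⟪T u, v⟫ = ⟪u, T v⟫) (p : ℕ) :
    inFSpan (fun j => b j) p (truncOp b T p) :=
  ⟨fun j l => ⟪b j, T (b l)⟫, fun j l => by dsimp only; rw [← hT, real_inner_comm], rfl⟩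

theorem tendsto_truncVec (b : HilbertBasis ℕ ℝ H) (x : H) :
    Tendsto (truncVec b x) atTop (nhds x) := by
  have h := (b.hasSum_repr x).tendsto_sum_nat
  simp only [b.repr_apply_apply] at h
  refine h.congr fun p => ?_
  rw [truncVec, Finset.sum_range]

theorem inner_truncOp (b : HilbertBasis ℕ ℝ H) (T : H →L[ℝ] H) (x : H) (p : ℕ) :
    ⟪x, truncOp b T p x⟫ = ⟪truncVec b x p, T (truncVec b x p)⟫ := by
  simp only [truncOp, truncVec, rankOne, sum_apply,
    smul_apply, ContinuousLinearMap.smulRight_apply, innerSL_apply_apply,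
    map_sum, map_smul, sum_inner, inner_sum, inner_smul_left, inner_smul_right, Finset.mul_sum]
  rw [Finset.sum_comm]
  refine Finset.sum_congr rfl fun l _ => Finset.sum_congr rfl fun j _ => ?_
  simp only [conj_trivial, real_inner_comm x]
  ring

theorem tendsto_integral_rho_truncation {Ω : Type*} [MeasureSpace Ω]
    [IsProbabilityMeasure (volume : Measure Ω)] [MeasurableSpace H] [BorelSpace H]
    {ρ : ℝ → ℝ} (hρ : IsBoundedRho ρ) {X : Ω → H} {ε : Ω → ℝ} (hX : Measurable X)
    (hε : Measurable ε) (μ : H) (α : ℝ) (β : H) (T : H →L[ℝ] H) (σ : ℝ)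
    (b : HilbertBasis ℕ ℝ H) :
    Tendsto (fun p => ∫ ω, ρ (ε ω + (α - α + (⟪X ω - μ, β⟫ - ⟪X ω - μ, truncVec b β p⟫) +
        (⟪X ω - μ, T (X ω - μ)⟫ - ⟪X ω - μ, truncOp b T p (X ω - μ)⟫)) / σ))
      atTop (nhds (∫ ω, ρ (ε ω))) := by
  have hcont : Continuous ρ := hρ.2.2.1
  refine tendsto_integral_of_dominated_convergence (fun _ => 1) (fun p => ?_)
    (integrable_const 1)
    (fun p => Eventually.of_forall fun ω => by simpa [abs_of_nonneg (hρ.1 _)] using hρ.2.1 _)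
    (Eventually.of_forall fun ω => ?_)
  · have hφ : Measurable fun x : H => (α - α + (⟪x - μ, β⟫ - ⟪x - μ, truncVec b β p⟫) +
        (⟪x - μ, T (x - μ)⟫ - ⟪x - μ, truncOp b T p (x - μ)⟫)) / σ :=
      Continuous.measurable (by fun_prop)
    exact (hcont.measurable.comp (hε.add (hφ.comp hX))).aestronglyMeasurable
  · simp only [inner_truncOp]
    have hβ := tendsto_truncVec b β
    have hx := tendsto_truncVec b (X ω - μ)
    have h₁ := (tendsto_const_nhds (x := X ω - μ)).inner (𝕜 := ℝ) hβ
    have h₂ := hx.inner (𝕜 := ℝ) ((T.continuous.tendsto _).comp hx)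
    have h := ((((h₁.const_sub ⟪X ω - μ, β⟫).const_add (α - α)).add
      (h₂.const_sub ⟪X ω - μ, T (X ω - μ)⟫)).div_const σ).const_add (ε ω)
    simpa [Function.comp_def] using (hcont.tendsto _).comp h

/-- Proposition 3.2: under the centered functional quadratic model with
`E‖X‖² < ∞`, if `(α_p(P), β_p(P), Υ_p(P))` minimizes the risk over
`C_p = ℝ × H_p × F_p` (built from the orthonormal eigenfunctions of the covariance
operator `Γ` of `X`), then the minimal risk over `C_p` converges, as `p → ∞`, to
`L(α₀, β₀, Υ₀, μ, σ₀)`. -/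
theorem statement1
    {Ω H : Type*} [MeasureSpace Ω] [IsProbabilityMeasure (volume : Measure Ω)]
    [NormedAddCommGroup H] [InnerProductSpace ℝ H] [CompleteSpace H]
    [MeasurableSpace H] [BorelSpace H]
    (X : Ω → H) (ε y : Ω → ℝ) (hX : Measurable X) (hε : Measurable ε)
    (hX2 : Integrable (fun ω => ‖X ω‖ ^ 2) (volume : Measure Ω))
    (μ : H) (α₀ : ℝ) (β₀ : H) (Υ₀ : H →L[ℝ] H) (σ₀ : ℝ) (hσ₀ : 0 < σ₀)
    (hsa₀ : ∀ u v : H, ⟪Υ₀ u, v⟫ = ⟪u, Υ₀ v⟫) (hHS₀ : IsHilbertSchmidt Υ₀)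
    (hmodel : ∀ ω, y ω = α₀ + ⟪β₀, X ω - μ⟫ + ⟪X ω - μ, Υ₀ (X ω - μ)⟫ + σ₀ * ε ω)
    (hindep : ProbabilityTheory.IndepFun ε X (volume : Measure Ω))
    (hdens : HasSymmUnimodalDensity ε)
    -- the covariance operator and its orthonormal eigenfunctions
    (Γ : H →L[ℝ] H)
    (hΓ : ∀ f g : H, ⟪f, Γ g⟫ = ∫ ω, ⟪X ω - μ, f⟫ * ⟪X ω - μ, g⟫)
    (b : HilbertBasis ℕ ℝ H) (heigen : ∀ j : ℕ, ∃ l : ℝ, Γ (b j) = l • b j)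
    (ρ₁ : ℝ → ℝ) (hρ₁ : IsBoundedRho ρ₁)
    -- for each `p`, `(αs p, βs p, Υs p)` minimizes the risk over `C_p`
    (αs : ℕ → ℝ) (βs : ℕ → H) (Υs : ℕ → (H →L[ℝ] H))
    (hmem : ∀ p : ℕ, inSpan (fun j => b j) p (βs p) ∧ inFSpan (fun j => b j) p (Υs p))
    (hmin : ∀ (p : ℕ) (a : ℝ) (β : H) (Υ : H →L[ℝ] H),
      inSpan (fun j => b j) p β → inFSpan (fun j => b j) p Υ →
      risk ρ₁ y X (αs p) (βs p) (Υs p) μ σ₀ ≤ risk ρ₁ y X a β Υ μ σ₀) :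
    Tendsto (fun p => risk ρ₁ y X (αs p) (βs p) (Υs p) μ σ₀) atTop
      (nhds (risk ρ₁ y X α₀ β₀ Υ₀ μ σ₀)) := by
  have hres : ∀ (a : ℝ) (β : H) (Υ : H →L[ℝ] H), risk ρ₁ y X a β Υ μ σ₀ =
      ∫ ω, ρ₁ (ε ω + (α₀ - a + (⟪X ω - μ, β₀⟫ - ⟪X ω - μ, β⟫) +
        (⟪X ω - μ, Υ₀ (X ω - μ)⟫ - ⟪X ω - μ, Υ (X ω - μ)⟫)) / σ₀) := by
    intro a β Υ
    unfold risk
    congr! 3 with ω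
    rw [hmodel ω, real_inner_comm β₀]
    field_simp
    ring
  have hres₀ : risk ρ₁ y X α₀ β₀ Υ₀ μ σ₀ = ∫ ω, ρ₁ (ε ω) := by
    rw [hres]
    simp
  have hlower : ∀ (a : ℝ) (β : H) (Υ : H →L[ℝ] H),
      risk ρ₁ y X α₀ β₀ Υ₀ μ σ₀ ≤ risk ρ₁ y X a β Υ μ σ₀ := by
    intro a β Υ
    rw [hres₀, hres]
    have hφ : Measurable fun x : H => (α₀ - a + (⟪x - μ, β₀⟫ - ⟪x - μ, β⟫) +
        (⟪x - μ, Υ₀ (x - μ)⟫ - ⟪x - μ, Υ (x - μ)⟫)) / σ₀ :=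
      Continuous.measurable (by fun_prop)
    exact integral_rho_le_integral_rho_add_of_indepFun hρ₁ hdens hε (hφ.comp hX)
      (hindep.comp measurable_id hφ)
  have hupper := tendsto_integral_rho_truncation hρ₁ hX hε μ α₀ β₀ Υ₀ σ₀ b
  refine tendsto_of_tendsto_of_tendsto_of_le_of_le tendsto_const_nhds (hres₀ ▸ hupper)
    (fun p => hlower _ _ _) fun p => ?_
  have hle := hmin p α₀ _ _ (inSpan_truncVec b β₀ p) (inFSpan_truncOp b hsa₀ p)
  rwa [hres α₀] at hle
end
end
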